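/- Let $q$ be a prime power, $n \ge 1$ and $k \ge 1$ integers, and let $A(x) = \sum_{i=0}^k a_i x^{q^i} \in \mathbb{F}_{q^n}[x]$ be a monic $q$-linearized polynomial ($a_k = 1$) of degree $q^k > 1$ dividing $x^{q^n} - x$ (so $a_0 \ne 0$). Here a polynomial is called $q$-linearized if it has the form $\sum_i c_i x^{q^i}$. For a $q$-linearized polynomial $B \in \mathbb{F}_{q^n}[x]$ whose coefficient of $x$ is $b_0$, put $\mathcal{W}(B \mid \mathbb{F}_{q^n}) = \{F \in \mathbb{F}_{q^n}[x] : B(F(x)) = -b_0 (x^{q^n} - x) F'(x)\}$, where $F'$ is the formal derivative. Let $d$ be the least positive integer for which there exist a $q$-linearized polynomial $M \in \mathbb{F}_{q^n}[x]$ and nonzero $a, b \in \mathbb{F}_{q^n}$ with $A(M(x)) = a x^{q^d} + b x$. Suppose $M_0 \in \mathbb{F}_{q^n}[x]$ is a $q$-linearized polynomial and $\alpha \in \mathbb{F}_{q^n}$ is nonzero with $A(M_0(x)) = x^{q^d} - \alpha x$. Then $$\mathcal{W}(A \mid \mathbb{F}_{q^n}) = \{M_0(G(x)) : G \in \mathcal{W}(x^{q^d}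 - \alpha x \mid \mathbb{F}_{q^n})\},$$ where $\mathcal{W}(x^{q^d} - \alpha x \mid \mathbb{F}_{q^n}) = \{G \in \mathbb{F}_{q^n}[x] : G(x)^{q^d} - \alpha G(x) = \alpha (x^{q^n} - x) G'(x)\}$. -/

import Mathlib

open Polynomial

/-- The `q`-linearized polynomial `∑_{i=0}^k aᵢ x^{q^i}` with prescribed coefficients. -/
noncomputable def linearizedPoly {K : Type*} [Field K] (q k : ℕ) (a : ℕ → K) : K[X] :=
  ∑ i ∈ Finset.range (k + 1), C (a i) * X ^ q ^ i

/-- `M` is `q`-linearized: it has the form `∑_{i=0}^s aᵢ x^{q^i}`. -/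
def IsLinearized {K : Type*} [Field K] (q : ℕ) (M : K[X]) : Prop :=
  ∃ (s : ℕ) (a : ℕ → K), M = linearizedPoly q s a

/-- `𝒲(A | 𝔽_{q^n}) = {F : A(F(x)) = -a₀ (x^{q^n} - x) F'(x)}`, where `a₀` is the coefficient
of `x` in the `q`-linearized polynomial `A`. -/
def polyW {K : Type*} [Field K] (q n : ℕ) (A : K[X]) : Set K[X] :=
  {F | A.comp F = -C (A.coeff 1) * (X ^ q ^ n - X) * derivative F}

/-- The positive integers `d` such that `A(M(x)) = a x^{q^d} + b x` for some `q`-linearized `M`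
and some nonzero `a`, `b`. -/
def binomialExponents {K : Type*} [Field K] (q : ℕ) (A : K[X]) : Set ℕ :=
  {d | 0 < d ∧ ∃ (M : K[X]) (a b : K), IsLinearized q M ∧ a ≠ 0 ∧ b ≠ 0 ∧
    A.comp M = C a * X ^ q ^ d + C b * X}

section LinearizedComposition

variable {K : Type*} [Field K]

theorem linearizedPoly_comp (q k : ℕ) (a : ℕ → K) (F : K[X]) :
    (linearizedPoly q k a).comp F = ∑ i ∈ Finset.range (k + 1), C (a i) * F ^ q ^ i := by
  simp [linearizedPoly]

theorem linearizedPoly_coeff {q : ℕ} (hq : 1 < q) (k : ℕ) (a : ℕ → K) (i : ℕ) :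
    (linearizedPoly q k a).coeff (q ^ i) = if i ≤ k then a i else 0 := by
  simp [linearizedPoly, finsetSum_coeff, coeff_C_mul, coeff_X_pow,
    Nat.pow_right_inj hq]

theorem isLinearized_iff {q : ℕ} (hq : 1 < q) (M : K[X]) :
    IsLinearized q M ↔ ∀ m, M.coeff m ≠ 0 → ∃ i, m = q ^ i := by
  constructor
  · rintro ⟨s, a, rfl⟩ m hm
    by_contra! h
    apply hm
    simp [linearizedPoly, finsetSum_coeff, coeff_C_mul, coeff_X_pow, h]
  · intro h
    refine ⟨M.natDegree, fun i => M.coeff (q ^ i), ?_⟩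
    ext m
    by_cases hm : ∃ i, m = q ^ i
    · obtain ⟨i, rfl⟩ := hm
      rw [linearizedPoly_coeff hq]
      split_ifs with hi
      · rfl
      · exact coeff_eq_zero_of_natDegree_lt ((not_le.1 hi).trans (Nat.lt_pow_self hq))
    · have h0 : M.coeff m = 0 := by
        by_contra h'
        exact hm (h m h')
      push Not at hm
      simp [h0, linearizedPoly, finsetSum_coeff, coeff_C_mul, coeff_X_pow, hm]

theorem IsLinearized.sub {q : ℕ} (hq : 1 < q) {M N : K[X]} (hM : IsLinearized q M)
    (hN : IsLinearized q N) : IsLinearized q (M - N) := by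
  rw [isLinearized_iff hq] at *
  intro m hm
  by_cases h : M.coeff m = 0
  · exact hN m fun h' => hm (by simp [h, h'])
  · exact hM m h

theorem IsLinearized.add {q : ℕ} (hq : 1 < q) {M N : K[X]} (hM : IsLinearized q M)
    (hN : IsLinearized q N) : IsLinearized q (M + N) := by
  rw [isLinearized_iff hq] at *
  intro m hm
  by_cases h : M.coeff m = 0
  · exact hN m fun h' => hm (by simp [h, h'])
  · exact hM m h

theorem isLinearized_monomial {q : ℕ} (hq : 1 < q) (c : K) (j : ℕ) :
    IsLinearized q (C c * X ^ q ^ j) := by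
  rw [isLinearized_iff hq]
  intro m hm
  rw [coeff_C_mul, coeff_X_pow] at hm
  exact ⟨j, by_contra fun h => hm (by simp [h])⟩

theorem IsLinearized.coeff_zero {q : ℕ} (hq : 1 < q) {M : K[X]} (hM : IsLinearized q M) :
    M.coeff 0 = 0 := by
  by_contra h
  obtain ⟨i, hi⟩ := (isLinearized_iff hq M).1 hM 0 h
  exact (pow_pos (by omega : 0 < q) i).ne hi

theorem IsLinearized.dvd_comp {q : ℕ} (hq : 1 < q) {M : K[X]} (hM : IsLinearized q M)
    (F : K[X]) : F ∣ M.comp F := by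
  obtain ⟨N, rfl⟩ := X_dvd_iff.2 (hM.coeff_zero hq)
  simp

theorem IsLinearized.comp_zero {q : ℕ} (hq : 1 < q) {M : K[X]} (hM : IsLinearized q M) :
    M.comp 0 = 0 :=
  zero_dvd_iff.1 (hM.dvd_comp hq 0)

theorem IsLinearized.eq_zero_of_natDegree_eq_zero {q : ℕ} (hq : 1 < q) {M : K[X]}
    (hM : IsLinearized q M) (h : M.natDegree = 0) : M = 0 := by
  rw [eq_C_of_natDegree_eq_zero h, hM.coeff_zero hq, C_0]

theorem linearizedPoly_natDegree_le {q : ℕ} (hq : 1 < q) (k : ℕ) (a : ℕ → K) :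
    (linearizedPoly q k a).natDegree ≤ q ^ k := by
  refine natDegree_sum_le_of_forall_le _ _ fun i hi => ?_
  exact (natDegree_C_mul_X_pow_le _ _).trans
    (Nat.pow_le_pow_right hq.le (Nat.lt_succ_iff.1 (Finset.mem_range.1 hi)))

theorem linearizedPoly_natDegree {q : ℕ} (hq : 1 < q) {k : ℕ} {a : ℕ → K} (ha : a k = 1) :
    (linearizedPoly q k a).natDegree = q ^ k := by
  refine natDegree_eq_of_le_of_coeff_ne_zero (linearizedPoly_natDegree_le hq k a) ?_
  simp [linearizedPoly_coeff hq, ha]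

theorem linearizedPoly_monic {q : ℕ} (hq : 1 < q) {k : ℕ} {a : ℕ → K} (ha : a k = 1) :
    (linearizedPoly q k a).Monic := by
  rw [Monic, leadingCoeff, linearizedPoly_natDegree hq ha, linearizedPoly_coeff hq]
  simp [ha]

theorem IsLinearized.comp_monomial {q : ℕ} (hq : 1 < q) {M : K[X]} (hM : IsLinearized q M)
    (c : K) (j : ℕ) : IsLinearized q (M.comp (C c * X ^ q ^ j)) := by
  obtain ⟨s, a, rfl⟩ := hM
  rw [linearizedPoly_comp]
  refine Finset.sum_induction _ (IsLinearized q) (fun _ _ => IsLinearized.add hq) ?_ ?_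
  · simpa using isLinearized_monomial hq (0 : K) 0
  · intro i _
    rw [mul_pow, ← C_pow, ← mul_assoc, ← C_mul, ← pow_mul X, ← pow_add]
    exact isLinearized_monomial hq _ _

section CharP

variable {p r : ℕ} [ExpChar K p]

theorem IsLinearized.comp_add {M : K[X]} (hM : IsLinearized (p ^ r) M) (F G : K[X]) :
    M.comp (F + G) = M.comp F + M.comp G := by
  obtain ⟨s, a, rfl⟩ := hM
  simp_rw [linearizedPoly_comp, ← Finset.sum_add_distrib, ← mul_add, ← pow_mul,
    add_pow_expChar_pow]

theorem IsLinearized.comp_sub {M : K[X]} (hM : IsLinearized (p ^ r) M) (F G : K[X]) :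
    M.comp (F - G) = M.comp F - M.comp G := by
  rw [eq_sub_iff_add_eq, ← hM.comp_add, sub_add_cancel]

theorem IsLinearized.comp_sum {M : K[X]} (hq : 1 < p ^ r) (hM : IsLinearized (p ^ r) M)
    {ι : Type*} (s : Finset ι) (F : ι → K[X]) :
    M.comp (∑ i ∈ s, F i) = ∑ i ∈ s, M.comp (F i) := by
  classical
  induction s using Finset.induction_on with
  | empty => simpa using hM.comp_zero hq
  | insert i s hi ih => rw [Finset.sum_insert hi, Finset.sum_insert hi, hM.comp_add, ih]

theorem coeff_pow_expChar_pow (F : K[X]) (j m : ℕ) :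
    (F ^ p ^ j).coeff m = if p ^ j ∣ m then F.coeff (m / p ^ j) ^ p ^ j else 0 := by
  rw [← map_iterateFrobenius_expand p F j, coeff_map,
    coeff_expand (pow_pos (expChar_pos K p) j)]
  split_ifs
  · rw [iterateFrobenius_def]
  · rw [map_zero]

theorem coeff_pow_pow_expChar_pow (F : K[X]) (j m : ℕ) :
    (F ^ (p ^ r) ^ j).coeff m =
      if (p ^ r) ^ j ∣ m then F.coeff (m / (p ^ r) ^ j) ^ (p ^ r) ^ j else 0 := by
  rw [← pow_mul]
  exact coeff_pow_expChar_pow F (r * j) m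

theorem IsLinearized.monomial_comp (hq : 1 < p ^ r) {M : K[X]} (hM : IsLinearized (p ^ r) M)
    (c : K) (j : ℕ) : IsLinearized (p ^ r) ((C c * X ^ (p ^ r) ^ j).comp M) := by
  rw [isLinearized_iff hq] at *
  intro m hm
  simp only [mul_comp, C_comp, X_pow_comp, coeff_C_mul, coeff_pow_pow_expChar_pow] at hm
  split_ifs at hm with h
  · obtain ⟨t, rfl⟩ := h
    have hpos : 0 < (p ^ r) ^ j := pow_pos (by omega) j
    rw [Nat.mul_div_cancel_left _ hpos] at hm
    obtain ⟨i, rfl⟩ := hM t fun h0 => hm (by rw [h0, zero_pow hpos.ne', mul_zero])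
    exact ⟨j + i, (pow_add _ _ _).symm⟩
  · simp at hm

/-- Right division of a linearized polynomial by a monic one, with respect to composition. -/
theorem IsLinearized.exists_comp_add (hq : 1 < p ^ r) {A : K[X]} (hA : IsLinearized (p ^ r) A)
    {k : ℕ} (hmonic : A.Monic) (hdeg : A.natDegree = (p ^ r) ^ k) {Z : K[X]}
    (hZ : IsLinearized (p ^ r) Z) :
    ∃ Q R : K[X], IsLinearized (p ^ r) Q ∧ R.natDegree < (p ^ r) ^ k ∧ Z = Q.comp A + R := by
  induction hN : Z.natDegree using Nat.strong_induction_on generalizing Z with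
  | _ N ih =>
  by_cases hlt : Z.natDegree < (p ^ r) ^ k
  · exact ⟨0, Z, by simpa using isLinearized_monomial hq (0 : K) 0, hlt, by simp⟩
  have hpos : ∀ j, 0 < (p ^ r) ^ j := fun j => pow_pos (by omega) j
  have hZ0 : Z ≠ 0 := by
    rintro rfl
    exact hlt (by simpa using hpos k)
  obtain ⟨t, ht⟩ := (isLinearized_iff hq Z).1 hZ _ (leadingCoeff_ne_zero.2 hZ0)
  have hkt : k ≤ t := by
    rw [ht, not_lt] at hlt
    exact (Nat.pow_le_pow_iff_right hq).1 hlt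
  set z := Z.leadingCoeff with hz
  have hz0 : z ≠ 0 := leadingCoeff_ne_zero.2 hZ0
  set U := C z * X ^ (p ^ r) ^ (t - k) with hU
  have hUA : U.comp A = C z * A ^ (p ^ r) ^ (t - k) := by simp [hU]
  have hUdeg : (U.comp A).natDegree = Z.natDegree := by
    rw [hUA, natDegree_C_mul hz0, natDegree_pow, hdeg, ht, ← pow_add, Nat.sub_add_cancel hkt]
  have hUlead : (U.comp A).leadingCoeff = Z.leadingCoeff := by
    rw [hUA, leadingCoeff_mul, leadingCoeff_C, leadingCoeff_pow, hmonic.leadingCoeff]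
    simp [hz]
  have hUA0 : U.comp A ≠ 0 := by
    rw [← leadingCoeff_ne_zero, hUlead]
    exact hz0
  have hlin : IsLinearized (p ^ r) (Z - U.comp A) := hZ.sub hq (hA.monomial_comp hq _ _)
  have hdlt : (Z - U.comp A).degree < Z.degree :=
    degree_sub_lt_left (by rw [degree_eq_natDegree hZ0, degree_eq_natDegree hUA0, hUdeg]) hZ0
      hUlead.symm
  have hnlt : (Z - U.comp A).natDegree < N := by
    rw [← hN]
    by_cases h0 : Z - U.comp A = 0
    · rw [h0, natDegree_zero, ht]
      exact hpos t
    · exact natDegree_lt_natDegree h0 hdlt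
  obtain ⟨Q, R, hQ, hR, h⟩ := ih _ hnlt hlin rfl
  refine ⟨Q + U, R, hQ.add hq (isLinearized_monomial hq _ _), hR, ?_⟩
  rw [add_comp]
  linear_combination h

end CharP

end LinearizedComposition

section OrbitPart

variable {K : Type*} [Field K]

/-- The linearized polynomial whose coefficient at `x^{q^i}` is that of `F` at `x^{w q^i}`. -/
noncomputable def orbitPart (q w : ℕ) (F : K[X]) : K[X] :=
  linearizedPoly q F.natDegree fun i => F.coeff (w * q ^ i)

theorem isLinearized_orbitPart (q w : ℕ) (F : K[X]) : IsLinearized q (orbitPart q w F) :=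
  ⟨_, _, rfl⟩

theorem orbitPart_coeff {q w : ℕ} (hq : 1 < q) (hw : 0 < w) (F : K[X]) (i : ℕ) :
    (orbitPart q w F).coeff (q ^ i) = F.coeff (w * q ^ i) := by
  rw [orbitPart, linearizedPoly_coeff hq]
  split_ifs with hi
  · rfl
  · refine (coeff_eq_zero_of_natDegree_lt ?_).symm
    exact ((not_le.1 hi).trans (Nat.lt_pow_self hq)).trans_le (Nat.le_mul_of_pos_left _ hw)

theorem orbitPart_coeff_of_ne {q : ℕ} (hq : 1 < q) (w : ℕ) (F : K[X]) {m : ℕ}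
    (hm : ∀ i, m ≠ q ^ i) : (orbitPart q w F).coeff m = 0 := by
  by_contra h
  obtain ⟨i, hi⟩ := (isLinearized_iff hq _).1 (isLinearized_orbitPart q w F) m h
  exact hm i hi

theorem pow_dvd_mul_pow_iff {q w : ℕ} (hq : 1 < q) (hw : ¬ q ∣ w) (i s : ℕ) :
    q ^ i ∣ w * q ^ s ↔ i ≤ s := by
  constructor
  · intro h
    by_contra! hlt
    obtain ⟨t, rfl⟩ := Nat.exists_eq_add_of_lt hlt
    rw [show s + t + 1 = (t + 1) + s by ring, pow_add] at h
    have := Nat.dvd_of_mul_dvd_mul_right (pow_pos (by omega) s) h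
    exact hw ((dvd_pow_self q (Nat.succ_ne_zero t)).trans this)
  · exact fun h => (pow_dvd_pow q h).mul_left w

theorem comp_orbitPart {p r w : ℕ} [ExpChar K p] (hq : 1 < p ^ r) (hw : ¬ p ^ r ∣ w)
    (k : ℕ) (a : ℕ → K) (F : K[X]) :
    (linearizedPoly (p ^ r) k a).comp (orbitPart (p ^ r) w F) =
      orbitPart (p ^ r) w ((linearizedPoly (p ^ r) k a).comp F) := by
  have hw0 : 0 < w := Nat.pos_of_ne_zero (by rintro rfl; simp at hw)
  have hpos : ∀ j, 0 < (p ^ r) ^ j := fun j => pow_pos (by omega) j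
  ext m
  by_cases hm : ∃ s, m = (p ^ r) ^ s
  · obtain ⟨s, rfl⟩ := hm
    rw [orbitPart_coeff hq hw0, linearizedPoly_comp, linearizedPoly_comp, finsetSum_coeff,
      finsetSum_coeff]
    refine Finset.sum_congr rfl fun i _ => ?_
    rw [coeff_C_mul, coeff_C_mul, coeff_pow_pow_expChar_pow, coeff_pow_pow_expChar_pow]
    simp only [pow_dvd_mul_pow_iff hq hw, Nat.pow_dvd_pow_iff_le_right hq]
    split_ifs with his
    · obtain ⟨t, rfl⟩ := Nat.exists_eq_add_of_le his
      rw [pow_add, Nat.mul_div_cancel_left _ (hpos i), orbitPart_coeff hq hw0,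
        mul_left_comm, Nat.mul_div_cancel_left _ (hpos i)]
    · rfl
  · push Not at hm
    rw [orbitPart_coeff_of_ne hq _ _ hm, linearizedPoly_comp, finsetSum_coeff]
    refine Finset.sum_eq_zero fun i _ => ?_
    rw [coeff_C_mul, coeff_pow_pow_expChar_pow]
    split_ifs with h
    · obtain ⟨t, rfl⟩ := h
      rw [Nat.mul_div_cancel_left _ (hpos i), orbitPart_coeff_of_ne hq, zero_pow (hpos i).ne',
        mul_zero]
      rintro s rfl
      exact hm (i + s) (pow_add _ _ _).symm
    · simp

theorem eq_C_add_sum_orbitPart {q : ℕ} (hq : 1 < q) (F : K[X]) :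
    F = C (F.coeff 0) + ∑ w ∈ (Finset.range (F.natDegree + 1)).filter (¬ q ∣ ·),
      (orbitPart q w F).comp (X ^ w) := by
  have hpow : ∀ j, 0 < q ^ j := fun j => pow_pos (by omega) j
  ext m
  rw [coeff_add, finsetSum_coeff]
  have hcoeff : ∀ w ∈ (Finset.range (F.natDegree + 1)).filter (¬ q ∣ ·),
      ((orbitPart q w F).comp (X ^ w)).coeff m =
        if w ∣ m then (orbitPart q w F).coeff (m / w) else 0 := by
    intro w hw
    have hw0 : 0 < w :=
      Nat.pos_of_ne_zero (by rintro rfl; simp at hw)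
    rw [← expand_eq_comp_X_pow, coeff_expand hw0]
  rw [Finset.sum_congr rfl hcoeff]
  rcases Nat.eq_zero_or_pos m with rfl | hm
  · rw [Finset.sum_eq_zero]
    · simp
    · intro w _
      simp [(isLinearized_orbitPart q w F).coeff_zero hq]
  rw [coeff_C, if_neg hm.ne', zero_add]
  obtain ⟨e, u, hu, rfl⟩ := Nat.exists_eq_pow_mul_and_not_dvd hm.ne' q (by omega)
  have hu0 : 0 < u := Nat.pos_of_ne_zero (by rintro rfl; simp at hu)
  rw [Finset.sum_eq_single u]
  · rw [if_pos (dvd_mul_left _ _), Nat.mul_div_cancel _ hu0, orbitPart_coeff hq hu0, mul_comm]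
  · intro w hw hwu
    have hwq : ¬ q ∣ w := (Finset.mem_filter.1 hw).2
    have hw0 : 0 < w := Nat.pos_of_ne_zero (by rintro rfl; simp at hwq)
    split_ifs with hd
    · obtain ⟨t, ht⟩ := hd
      rw [ht, Nat.mul_div_cancel_left _ hw0]
      refine orbitPart_coeff_of_ne hq _ _ ?_
      rintro s rfl
      have h1 : e ≤ s := (pow_dvd_mul_pow_iff hq hwq e s).1 ⟨u, ht.symm⟩
      have h2 : s ≤ e := (pow_dvd_mul_pow_iff hq hu s e).1 ⟨w, by rw [mul_comm, ht, mul_comm]⟩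
      obtain rfl := le_antisymm h1 h2
      rw [mul_comm w] at ht
      exact hwu (Nat.eq_of_mul_eq_mul_left (hpow e) ht).symm
    · rfl
  · intro h
    have hlt : F.natDegree < u := by
      by_contra! h'
      exact h (Finset.mem_filter.2 ⟨Finset.mem_range.2 (by omega), hu⟩)
    rw [if_pos (dvd_mul_left _ _), Nat.mul_div_cancel _ hu0, orbitPart_coeff hq hu0]
    exact coeff_eq_zero_of_natDegree_lt (hlt.trans_le (Nat.le_mul_of_pos_right _ (hpow e)))

/-- Under a degree bound, the orbit parts of `(x^{q^n} - x) F'` are binomials. -/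
theorem exists_orbitPart_eq_binomial {p r n w : ℕ} [CharP K p] (hr : 0 < r) (hq : 1 < p ^ r)
    (hw : ¬ p ^ r ∣ w) {F : K[X]} (hF : F.natDegree < (p ^ r) ^ n)
    (hwn : w < (p ^ r) ^ n) (c : K) :
    ∃ (m : ℕ) (a b : K), 0 < m ∧
      orbitPart (p ^ r) w (C c * (X ^ (p ^ r) ^ n - X) * derivative F) =
        C a * X ^ (p ^ r) ^ m + C b * X := by
  have hw0 : 0 < w := Nat.pos_of_ne_zero (by rintro rfl; simp at hw)
  set Q := p ^ r with hQ
  have hpow : ∀ j, 0 < Q ^ j := fun j => pow_pos (by omega) j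
  have hcoeff : ∀ i, (C c * (X ^ Q ^ n - X) * derivative F).coeff (w * Q ^ i) =
      c * (if Q ^ n ≤ w * Q ^ i then (derivative F).coeff (w * Q ^ i - Q ^ n) else 0) -
        if i = 0 then c * (F.coeff w * w) else 0 := by
    intro i
    obtain ⟨t, ht⟩ := Nat.exists_eq_succ_of_ne_zero (Nat.mul_pos hw0 (hpow i)).ne'
    have hX : (X * derivative F).coeff (w * Q ^ i) = if i = 0 then F.coeff w * w else 0 := by
      rw [ht, Nat.succ_eq_add_one, coeff_X_mul, coeff_derivative]
      have : ((t : K) + 1) = ((w * Q ^ i : ℕ) : K) := by rw [ht]; simp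
      rw [this, ← Nat.succ_eq_add_one, ← ht]
      split_ifs with hi
      · simp [hi]
      · simp [hQ, CharP.cast_eq_zero, hr.ne', hi]
    rw [mul_assoc, coeff_C_mul, sub_mul, coeff_sub, coeff_X_pow_mul', hX, mul_sub]
    simp only [mul_ite, mul_zero]
  have hbound : ∀ i, Q ^ n ≤ w * Q ^ i → (derivative F).coeff (w * Q ^ i - Q ^ n) ≠ 0 →
      w * Q ^ i < 2 * Q ^ n := by
    intro i h h0
    have h1 := le_natDegree_of_ne_zero h0
    have h2 := natDegree_derivative_le F
    omega
  obtain ⟨m, hm0, hm⟩ : ∃ m, 0 < m ∧ ∀ i, i ≠ m → Q ^ n ≤ w * Q ^ i →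
      (derivative F).coeff (w * Q ^ i - Q ^ n) = 0 := by
    have hex : ∃ i, Q ^ n ≤ w * Q ^ i := ⟨n, Nat.le_mul_of_pos_left _ hw0⟩
    classical
    refine ⟨Nat.find hex, ?_, ?_⟩
    · rw [Nat.find_pos]
      simpa using hwn
    · intro i hi hle
      by_contra h0
      have h1 : Nat.find hex + 1 ≤ i :=
        lt_of_le_of_ne (Nat.find_min' hex hle) hi.symm
      have h2 := Nat.pow_le_pow_right (by omega : 0 < Q) h1
      have h3 := Nat.find_spec hex
      have h4 := hbound i hle h0
      have h5 : w * Q ^ Nat.find hex * 2 ≤ w * Q ^ i := by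
        refine le_trans ?_ (Nat.mul_le_mul_left w h2)
        rw [pow_succ, ← mul_assoc]
        exact Nat.mul_le_mul_left _ hq
      omega
  refine ⟨m, c * (if Q ^ n ≤ w * Q ^ m then (derivative F).coeff (w * Q ^ m - Q ^ n) else 0),
    -(c * (F.coeff w * w)), hm0, ?_⟩
  ext t
  rw [coeff_add, coeff_C_mul_X_pow, coeff_C_mul_X]
  by_cases ht : ∃ i, t = Q ^ i
  · obtain ⟨i, rfl⟩ := ht
    have h1 : Q ^ i = 1 ↔ i = 0 := by
      simpa using Nat.pow_right_inj hq (m := i) (n := 0)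
    rw [orbitPart_coeff hq hw0, hcoeff]
    simp only [Nat.pow_right_inj hq, h1]
    by_cases him : i = m
    · subst him
      simp [hm0.ne']
    · have h0 : (if Q ^ n ≤ w * Q ^ i then (derivative F).coeff (w * Q ^ i - Q ^ n)
          else 0) = 0 := by
        split_ifs with h
        · exact hm i him h
        · rfl
      rw [h0, if_neg him, mul_zero, zero_sub, zero_add]
      split_ifs <;> simp
  · push Not at ht
    rw [orbitPart_coeff_of_ne hq _ _ ht, if_neg (ht m),
      if_neg (by simpa using ht 0), add_zero]

end OrbitPart

section Factorization

variable {K : Type*} [Field K] {p r : ℕ} [ExpChar K p]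

theorem IsLinearized.eq_zero_of_comp_natDegree_le_one {q : ℕ} (hq : 1 < q) {A L : K[X]}
    (hA : 1 < A.natDegree) (hL : IsLinearized q L) (h : (A.comp L).natDegree ≤ 1) : L = 0 := by
  refine hL.eq_zero_of_natDegree_eq_zero hq ?_
  rw [natDegree_comp] at h
  by_contra h0
  have := Nat.le_mul_of_pos_right A.natDegree (Nat.pos_of_ne_zero h0)
  omega

/-- A composition with a separable linearized polynomial of degree `> 1` is not a monomial. -/
theorem IsLinearized.eq_zero_of_comp_eq_monomial {q : ℕ} (hq : 1 < q) {A L : K[X]}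
    (hA : IsLinearized q A) (hA1 : A.coeff 1 ≠ 0) (hdeg : 1 < A.natDegree)
    (hL : IsLinearized q L) {c : K} {m : ℕ} (h : A.comp L = C c * X ^ m) : L = 0 := by
  by_contra hL0
  have hdL : L.natDegree ≠ 0 := fun h0 => hL0 (hL.eq_zero_of_natDegree_eq_zero hq h0)
  obtain ⟨D, rfl⟩ := X_dvd_iff.2 (hA.coeff_zero hq)
  have hD0 : D.coeff 0 ≠ 0 := by simpa using hA1
  have hDne : D ≠ 0 := by rintro rfl; simp at hD0
  have hDdeg : D.natDegree ≠ 0 := by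
    rw [natDegree_X_mul hDne] at hdeg
    omega
  rw [mul_comp, X_comp] at h
  have hne : D.comp L ≠ 0 := by
    intro h0
    have := congrArg natDegree h0
    rw [natDegree_comp, natDegree_zero] at this
    exact Nat.mul_ne_zero hDdeg hdL this
  have hc : c ≠ 0 := by
    rintro rfl
    exact mul_ne_zero hL0 hne (by simpa using h)
  have hdvd : D.comp L ∣ X ^ m := by
    refine ⟨C c⁻¹ * L, ?_⟩
    have : C c⁻¹ * C c = (1 : K[X]) := by rw [← C_mul, inv_mul_cancel₀ hc, C_1]
    linear_combination (-C c⁻¹) * h - X ^ m * this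
  obtain ⟨i, -, hi⟩ := (dvd_prime_pow prime_X m).1 hdvd
  have hi0 : i ≠ 0 := by
    rintro rfl
    have := natDegree_eq_of_degree_eq (degree_eq_degree_of_associated hi)
    rw [natDegree_comp, pow_zero, natDegree_one] at this
    exact Nat.mul_ne_zero hDdeg hdL this
  have hX : X ∣ D.comp L := (dvd_pow_self X hi0).trans hi.symm.dvd
  rw [X_dvd_iff, coeff_zero_eq_eval_zero, eval_comp, ← coeff_zero_eq_eval_zero L,
    hL.coeff_zero hq, ← coeff_zero_eq_eval_zero] at hX
  exact hD0 hX

/-- Every `L` with `A ∘ L` a binomial factors through the minimal such polynomial `M₀`. -/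
theorem exists_comp_eq_of_comp_eq_binomial [Finite K] (hq : 1 < p ^ r) {A : K[X]}
    (hA : IsLinearized (p ^ r) A) (hdeg : 1 < A.natDegree) {d : ℕ}
    (hd : d ∈ lowerBounds (binomialExponents (p ^ r) A)) (hd0 : 0 < d) {M₀ : K[X]}
    (hM₀ : IsLinearized (p ^ r) M₀) {α : K} (hα : α ≠ 0)
    (hcomp : A.comp M₀ = X ^ (p ^ r) ^ d - C α * X) {m : ℕ} (hm : 0 < m) {L : K[X]}
    (hL : IsLinearized (p ^ r) L) {a b : K} (ha : a ≠ 0) (hb : b ≠ 0)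
    (hAL : A.comp L = C a * X ^ (p ^ r) ^ m + C b * X) : ∃ Q : K[X], L = M₀.comp Q := by
  induction m using Nat.strong_induction_on generalizing L a b with
  | _ m ih =>
  have hdm : d ≤ m := hd ⟨hm, L, a, b, hL, ha, hb, hAL⟩
  obtain ⟨c, hc⟩ := (bijective_iterateFrobenius K p (r * d)).2 a
  rw [iterateFrobenius_def, pow_mul] at hc
  have hc0 : c ≠ 0 := by
    rintro rfl
    rw [zero_pow (pow_pos (by omega) d).ne'] at hc
    exact ha hc.symm
  set U := C c * X ^ (p ^ r) ^ (m - d) with hU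
  have hUd : U ^ (p ^ r) ^ d = C a * X ^ (p ^ r) ^ m := by
    rw [hU, mul_pow, ← C_pow, hc, ← pow_mul, ← pow_add, Nat.sub_add_cancel hdm]
  have hlin : IsLinearized (p ^ r) (L - M₀.comp U) := hL.sub hq (hM₀.comp_monomial hq _ _)
  have hA' : A.comp (L - M₀.comp U) = C (α * c) * X ^ (p ^ r) ^ (m - d) + C b * X := by
    rw [hA.comp_sub, hAL, ← comp_assoc, hcomp, sub_comp, X_pow_comp, mul_comp, C_comp, X_comp,
      hUd, hU, C_mul]
    ring
  rcases hdm.eq_or_lt with rfl | hlt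
  · refine ⟨U, sub_eq_zero.1 (hlin.eq_zero_of_comp_natDegree_le_one hq hdeg ?_)⟩
    rw [hA', Nat.sub_self, pow_zero, pow_one, ← add_mul, ← C_add]
    exact (natDegree_C_mul_le _ _).trans natDegree_X_le
  · obtain ⟨Q, hQ⟩ := ih (m - d) (by omega) (by omega) hlin (mul_ne_zero hα hc0) hb hA'
    exact ⟨Q + U, by rw [hM₀.comp_add, ← hQ, sub_add_cancel]⟩

/-- A right factor of `x^{q^n} - x` is also a left factor, with respect to composition. -/
theorem exists_comp_eq_X_pow_sub_X [Fintype K] (hq : 1 < p ^ r) {n k : ℕ}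
    (hcard : Fintype.card K = (p ^ r) ^ n) {A : K[X]} (hA : IsLinearized (p ^ r) A)
    (hmonic : A.Monic) (hdeg : A.natDegree = (p ^ r) ^ k)
    (hdvd : A ∣ X ^ (p ^ r) ^ n - X) :
    ∃ B : K[X], IsLinearized (p ^ r) B ∧ A.comp B = X ^ (p ^ r) ^ n - X := by
  have hT : IsLinearized (p ^ r) (X ^ (p ^ r) ^ n - X : K[X]) := by
    have := (isLinearized_monomial hq (1 : K) n).sub hq (isLinearized_monomial hq (1 : K) 0)
    simpa using this
  obtain ⟨B, R, hB, hR, h⟩ := hA.exists_comp_add hq hmonic hdeg hT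
  have hR0 : R = 0 := by
    have hAR : A ∣ R := by
      rw [h] at hdvd
      exact (dvd_add_right (hB.dvd_comp hq A)).1 hdvd
    by_contra h0
    have := natDegree_le_of_dvd hAR h0
    omega
  rw [hR0, add_zero] at h
  refine ⟨B, hB, ?_⟩
  have hcentral : A.comp (X ^ (p ^ r) ^ n - X) = A ^ (p ^ r) ^ n - A := by
    rw [hA.comp_sub, comp_X, ← hcard, ← FiniteField.expand_card A, expand_eq_comp_X_pow]
  have hAdeg : A.natDegree ≠ 0 := by
    rw [hdeg]
    exact (pow_pos (by omega) k).ne'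
  have hzero : (A.comp B - (X ^ (p ^ r) ^ n - X)).comp A = 0 := by
    rw [sub_comp, comp_assoc, ← h, hcentral]
    simp
  rw [comp_eq_zero_iff] at hzero
  rcases hzero with h0 | ⟨-, h0⟩
  · exact sub_eq_zero.1 h0
  · exact absurd (by rw [h0, natDegree_C]) hAdeg

/-- The map induced on `K` by a composition cofactor of `A` in `x^{q^n} - x` hits every
zero of `A`. -/
theorem exists_eval_eq_of_eval_eq_zero [Fintype K] (hq : 1 < p ^ r) {n : ℕ}
    (hcard : Fintype.card K = (p ^ r) ^ n) {A B : K[X]} (hA : IsLinearized (p ^ r) A)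
    (hAB : A.comp B = X ^ (p ^ r) ^ n - X) {c : K} (hc : A.eval c = 0) :
    ∃ y, B.eval y = c := by
  have hcard1 : 1 < (p ^ r) ^ n := hcard ▸ Fintype.one_lt_card
  have hT0 : (X ^ (p ^ r) ^ n - X : K[X]) ≠ 0 := FiniteField.X_pow_card_sub_X_ne_zero K hcard1
  have hdvd : B - C c ∣ X ^ (p ^ r) ^ n - X := by
    have : A.comp (B - C c) = X ^ (p ^ r) ^ n - X := by
      rw [hA.comp_sub, hAB, comp_C, hc, C_0, sub_zero]
    rw [← this]
    exact hA.dvd_comp hq _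
  have hsplits : (X ^ (p ^ r) ^ n - X : K[X]).Splits := by
    rw [← hcard, ← Nat.card_eq_fintype_card]
    exact splits_X_pow_nat_card_sub_X
  have hdeg : (B - C c).degree ≠ 0 := by
    intro h0
    have hB : B.natDegree = 0 := by
      have := natDegree_eq_of_degree_eq_some h0
      rwa [natDegree_sub_C] at this
    have := congrArg natDegree hAB
    rw [natDegree_comp, hB, mul_zero, FiniteField.X_pow_card_sub_X_natDegree_eq K hcard1] at this
    omega
  obtain ⟨y, hy⟩ := (hsplits.of_dvd hT0 hdvd).exists_eval_eq_zero hdeg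
  exact ⟨y, sub_eq_zero.1 (by simpa using hy)⟩

end Factorization

section MinimalValueSet

variable {K : Type*} [Field K]

theorem natDegree_lt_of_mem_polyW {q n : ℕ} (hq : 1 < q) {A F : K[X]} (hA : 1 < A.natDegree)
    (hF : F ∈ polyW q n A) : F.natDegree < q ^ n := by
  have hpos : 0 < q ^ n := pow_pos (by omega) n
  by_contra! hle
  have h := congrArg natDegree (show A.comp F = _ from hF)
  rw [natDegree_comp] at h
  have h1 : (X ^ q ^ n - X : K[X]).natDegree ≤ q ^ n :=
    (natDegree_sub_le _ _).trans (by simpa using Nat.one_le_of_lt hpos)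
  have h2 := natDegree_derivative_le F
  have h3 : (-C (A.coeff 1) * (X ^ q ^ n - X) * derivative F).natDegree ≤
      0 + q ^ n + (F.natDegree - 1) := by
    refine natDegree_mul_le_of_le (natDegree_mul_le_of_le ?_ h1) h2
    simp
  have h4 := Nat.mul_le_mul_right F.natDegree hA
  omega

theorem derivative_linearizedPoly_comp {p r : ℕ} [CharP K p] (hr : 0 < r) {M : K[X]}
    (hq : 1 < p ^ r) (hM : IsLinearized (p ^ r) M) (G : K[X]) :
    derivative (M.comp G) = C (M.coeff 1) * derivative G := by
  obtain ⟨s, a, rfl⟩ := hM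
  have h1 : (linearizedPoly (p ^ r) s a).coeff 1 = a 0 := by
    simpa using linearizedPoly_coeff hq s a 0
  rw [h1, linearizedPoly_comp, derivative_sum, Finset.sum_eq_single 0]
  · simp
  · intro i _ hi
    simp [derivative_pow, hr.ne', hi]
  · simp

end MinimalValueSet

theorem stmt_18 {K : Type*} [Field K] [Fintype K] (q n k d : ℕ)
    (hq : IsPrimePow q) (hn : 1 ≤ n) (hcard : Fintype.card K = q ^ n)
    (hk : 1 ≤ k) (a : ℕ → K) (hak : a k = 1)
    (hdvd : linearizedPoly q k a ∣ X ^ q ^ n - X)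
    (hd : IsLeast (binomialExponents q (linearizedPoly q k a)) d)
    (M₀ : K[X]) (hM₀ : IsLinearized q M₀) (α : K) (hα : α ≠ 0)
    (hcomp : (linearizedPoly q k a).comp M₀ = X ^ q ^ d - C α * X) :
    polyW q n (linearizedPoly q k a) =
      {F : K[X] | ∃ G ∈ polyW q n (X ^ q ^ d - C α * X), F = M₀.comp G} := by
  obtain ⟨p, r, hp, hr, rfl⟩ := hq
  have hp' : p.Prime := hp.nat_prime
  have : Fact p.Prime := ⟨hp'⟩
  have hq : 1 < p ^ r := Nat.one_lt_pow hr.ne' hp'.one_lt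
  have : CharP K p := charP_of_card_eq_prime_pow (f := r * n) (by rw [hcard, pow_mul])
  have : ExpChar K p := ExpChar.prime hp'
  set A := linearizedPoly (p ^ r) k a with hAdef
  have hA : IsLinearized (p ^ r) A := ⟨k, a, rfl⟩
  have hAdeg : A.natDegree = (p ^ r) ^ k := linearizedPoly_natDegree hq hak
  have hAdeg1 : 1 < A.natDegree := hAdeg ▸ Nat.one_lt_pow (by omega) hq
  have hd0 : 0 < d := hd.1.1
  have hderiv : C (A.coeff 1) * C (M₀.coeff 1) = -C α := by
    have h := congrArg derivative hcomp
    rw [derivative_linearizedPoly_comp hr hq hA] at h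
    have h' := derivative_linearizedPoly_comp hr hq hM₀ X
    rw [comp_X, derivative_X, mul_one] at h'
    rw [h'] at h
    simpa [derivative_X_pow, hr.ne', hd0.ne'] using h
  have hA1 : A.coeff 1 ≠ 0 := by
    intro h0
    rw [h0] at hderiv
    exact hα (by simpa using hderiv.symm)
  have hB1 : (X ^ (p ^ r) ^ d - C α * X : K[X]).coeff 1 = -α := by
    have : 1 ≠ (p ^ r) ^ d := (Nat.one_lt_pow hd0.ne' hq).ne
    simp [coeff_X_pow, this]
  have hmem : ∀ G : K[X], M₀.comp G ∈ polyW (p ^ r) n A ↔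
      G ∈ polyW (p ^ r) n (X ^ (p ^ r) ^ d - C α * X) := by
    intro G
    simp only [polyW, Set.mem_ofPred_eq]
    rw [← comp_assoc, hcomp, derivative_linearizedPoly_comp hr hq hM₀, hB1]
    have : -C (A.coeff 1) * (X ^ (p ^ r) ^ n - X) * (C (M₀.coeff 1) * derivative G) =
        -C (-α) * (X ^ (p ^ r) ^ n - X) * derivative G := by
      rw [C_neg]
      linear_combination -(X ^ (p ^ r) ^ n - X) * derivative G * hderiv
    rw [this]
  ext F
  constructor
  · intro hF
    suffices h : ∃ G, F = M₀.comp G by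
      obtain ⟨G, rfl⟩ := h
      exact ⟨G, (hmem G).1 hF, rfl⟩
    have hFdeg := natDegree_lt_of_mem_polyW hq hAdeg1 hF
    have hFeq : A.comp F = -C (A.coeff 1) * (X ^ (p ^ r) ^ n - X) * derivative F := hF
    have hconst : ∃ y, M₀.eval y = F.coeff 0 := by
      obtain ⟨B, hB, hAB⟩ := exists_comp_eq_X_pow_sub_X hq hcard hA
        (linearizedPoly_monic hq hak) hAdeg hdvd
      have hc : A.eval (F.coeff 0) = 0 := by
        rw [coeff_zero_eq_eval_zero, ← eval_comp, hFeq]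
        have : p ≠ 0 := hp'.ne_zero
        simp [this]
      obtain ⟨y, hy⟩ := exists_eval_eq_of_eval_eq_zero hq hcard hA hAB hc
      obtain ⟨Q, rfl⟩ := exists_comp_eq_of_comp_eq_binomial hq hA hAdeg1 hd.2 hd0 hM₀ hα hcomp
        (m := n) hn hB one_ne_zero (neg_ne_zero.2 one_ne_zero)
        (by rw [hAB, C_neg, C_1]; ring)
      exact ⟨Q.eval y, by rw [← eval_comp, hy]⟩
    have horbit : ∀ w, w ∈ (Finset.range (F.natDegree + 1)).filter (¬ p ^ r ∣ ·) →
        ∃ Q, orbitPart (p ^ r) w F = M₀.comp Q := by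
      intro w hw
      obtain ⟨hwF, hwq⟩ := Finset.mem_filter.1 hw
      rw [Finset.mem_range] at hwF
      obtain ⟨m, e, b, hm, hmeq⟩ := exists_orbitPart_eq_binomial (n := n) hr hq hwq hFdeg
        (by omega) (-A.coeff 1)
      have hL := isLinearized_orbitPart (p ^ r) w F
      rw [C_neg, ← hFeq, hAdef, ← comp_orbitPart hq hwq, ← hAdef] at hmeq
      have hzero : orbitPart (p ^ r) w F = 0 → ∃ Q, orbitPart (p ^ r) w F = M₀.comp Q :=
        fun h => ⟨0, by rw [h, hM₀.comp_zero hq]⟩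
      by_cases he : e = 0
      · refine hzero (hA.eq_zero_of_comp_eq_monomial hq hA1 hAdeg1 hL (c := b) (m := 1) ?_)
        rw [hmeq, he, C_0, zero_mul, zero_add, pow_one]
      by_cases hb : b = 0
      · refine hzero (hA.eq_zero_of_comp_eq_monomial hq hA1 hAdeg1 hL (c := e)
          (m := (p ^ r) ^ m) ?_)
        rw [hmeq, hb, C_0, zero_mul, add_zero]
      exact exists_comp_eq_of_comp_eq_binomial hq hA hAdeg1 hd.2 hd0 hM₀ hα hcomp hm hL he hb hmeq
    obtain ⟨y, hy⟩ := hconst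
    choose! Q hQ using horbit
    refine ⟨C y + ∑ w ∈ (Finset.range (F.natDegree + 1)).filter (¬ p ^ r ∣ ·),
      (Q w).comp (X ^ w), ?_⟩
    rw [hM₀.comp_add, comp_C, hy, hM₀.comp_sum hq]
    conv_lhs => rw [eq_C_add_sum_orbitPart hq F]
    congr 1
    refine Finset.sum_congr rfl fun w hw => ?_
    rw [hQ w hw, comp_assoc]
  · rintro ⟨G, hG, rfl⟩
    exact (hmem G).2 hG
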